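/- Let K be a field, A a local Artinian K-algebra with maximal ideal m_A and residue field K, W a K-vector space and V ⊆ W a subspace. Let N ⊆ W ⊗_K A be an A-submodule that is flat over A and such that the reduction map W ⊗_K A → W (induced by A → A/m_A = K) sends N onto V with kernel m_A·N (equivalently, N ⊗_A K → W is injective with image V). Then there exists an A-linear automorphism f of W ⊗_K A with (f − id)(W ⊗_K A) ⊆ W ⊗_K m_A and f(V ⊗_K A) = N. Conversely, for any such automorphism f, the submodule f(V ⊗_K A) is free over A and reduces to V modulo m_A. -/

import Mathlib

open TensorProduct

/-- The reduction map `W ⊗ A → W` induced by the residue map `ε : A → A/m_A = K`. -/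
noncomputable def red (K A : Type*) [Field K] [CommRing A] [Algebra K A]
    (ε : A →ₐ[K] K) (W : Type*) [AddCommGroup W] [Module K W] :
    A ⊗[K] W →ₗ[K] W :=
  (TensorProduct.lid K W).toLinearMap ∘ₗ LinearMap.rTensor W ε.toLinearMap

theorem red_tmul' (K A : Type*) [Field K] [CommRing A] [Algebra K A]
    (ε : A →ₐ[K] K) (W : Type*) [AddCommGroup W] [Module K W] (a : A) (w : W) :
    red K A ε W (a ⊗ₜ w) = ε a • w := by
  simp [red]

theorem red_smul' (K A : Type*) [Field K] [CommRing A] [Algebra K A]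
    (ε : A →ₐ[K] K) (W : Type*) [AddCommGroup W] [Module K W] (a : A) (x : A ⊗[K] W) :
    red K A ε W (a • x) = ε a • red K A ε W x := by
  induction x with
  | zero => simp
  | add x y hx hy => simp only [smul_add, map_add, hx, hy]
  | tmul b w => rw [TensorProduct.smul_tmul', red_tmul', red_tmul', smul_eq_mul, map_mul, mul_smul]

theorem red_mem_zero (K A : Type*) [Field K] [CommRing A] [Algebra K A] [IsLocalRing A]
    (ε : A →ₐ[K] K) (hε : RingHom.ker (ε : A →+* K) = IsLocalRing.maximalIdeal A)
    (W : Type*) [AddCommGroup W] [Module K W] (x : A ⊗[K] W)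
    (hx : x ∈ IsLocalRing.maximalIdeal A • (⊤ : Submodule A (A ⊗[K] W))) :
    red K A ε W x = 0 := by
  induction hx using Submodule.smul_induction_on' with
  | smul r hr n hn =>
    rw [← hε] at hr
    have : ε r = 0 := hr
    rw [red_smul', this, zero_smul]
  | add x hx y hy h1 h2 => rw [map_add, h1, h2, add_zero]

theorem sub_red_mem (K A : Type*) [Field K] [CommRing A] [Algebra K A] [IsLocalRing A]
    (ε : A →ₐ[K] K) (hε : RingHom.ker (ε : A →+* K) = IsLocalRing.maximalIdeal A)
    (W : Type*) [AddCommGroup W] [Module K W] (x : A ⊗[K] W) :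
    x - 1 ⊗ₜ (red K A ε W x) ∈
      IsLocalRing.maximalIdeal A • (⊤ : Submodule A (A ⊗[K] W)) := by
  induction x with
  | zero => simp
  | add x y hx hy =>
    rw [map_add, TensorProduct.tmul_add, add_sub_add_comm]
    exact add_mem hx hy
  | tmul a w =>
    have h : a ⊗ₜ[K] w - 1 ⊗ₜ (red K A ε W (a ⊗ₜ w)) =
        (a - algebraMap K A (ε a)) • ((1 : A) ⊗ₜ[K] w) := by
      rw [red_tmul', TensorProduct.smul_tmul', smul_eq_mul, mul_one, TensorProduct.sub_tmul,
        ← TensorProduct.smul_tmul, Algebra.algebraMap_eq_smul_one]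
    rw [h]
    refine Submodule.smul_mem_smul ?_ trivial
    rw [← hε]
    change ε _ = 0
    simp

theorem nilp_nakayama {A M : Type*} [CommRing A] [AddCommGroup M] [Module A M]
    (I : Ideal A) (hI : IsNilpotent I) (N P : Submodule A M) (h : N ≤ P ⊔ I • N) : N ≤ P := by
  obtain ⟨n, hn⟩ := hI
  have key : ∀ k : ℕ, N ≤ P ⊔ I ^ k • N := by
    intro k
    induction k with
    | zero => simp
    | succ k ih =>
      refine h.trans (sup_le le_sup_left ?_)
      calc I • N ≤ I • (P ⊔ I ^ k • N) := Submodule.smul_mono le_rfl ih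
        _ = I • P ⊔ I ^ (k+1) • N := by rw [Submodule.smul_sup, ← Submodule.mul_smul, pow_succ']
        _ ≤ _ := sup_le_sup_right Submodule.smul_le_right _
  have := key n
  rw [hn] at this
  simpa using this

theorem bij_of_sub_mem {A M : Type*} [CommRing A] [AddCommGroup M] [Module A M]
    (I : Ideal A) (hI : IsNilpotent I) (f : M →ₗ[A] M)
    (h : ∀ x, f x - x ∈ I • (⊤ : Submodule A M)) : IsUnit f := by
  obtain ⟨n, hn⟩ := hI
  have key : ∀ (k : ℕ) (x : M), ((f - 1) ^ k) x ∈ I ^ k • (⊤ : Submodule A M) := by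
    intro k
    induction k with
    | zero => simp
    | succ k ih =>
      intro x
      rw [pow_succ (f - 1), Module.End.mul_apply, pow_succ, Submodule.mul_smul]
      have hx : (f - 1) x ∈ I • (⊤ : Submodule A M) := h x
      generalize (f - 1) x = y at hx
      induction hx using Submodule.smul_induction_on' with
      | smul r hr n hn =>
        rw [map_smul, ← Submodule.mul_smul, mul_comm, Submodule.mul_smul]
        exact Submodule.smul_mem_smul hr (ih n)
      | add x hx y hy h1 h2 => rw [map_add]; exact add_mem h1 h2
  have : IsNilpotent (f - 1) := ⟨n, by
    ext x
    have := key n x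
    rw [hn] at this
    simpa using this⟩
  simpa using this.isUnit_add_one

/-- Let `K` be a field, `A` a local Artinian `K`-algebra with maximal ideal `m_A`
and residue field `K` (the residue map being given by `ε : A → K`), `W` a
`K`-vector space and `V ⊆ W` a subspace.  Let `N ⊆ W ⊗ A` be an `A`-submodule
which is flat over `A` and such that the reduction map `W ⊗ A → W` sends `N`
onto `V` with kernel `m_A·N`.  Then there exists an `A`-linear automorphism `f`
of `W ⊗ A` with `(f − id)(W ⊗ A) ⊆ W ⊗ m_A` and `f(V ⊗ A) = N`.  Conversely,
for any such automorphism `f`, the submodule `f(V ⊗ A)` is free over `A` and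
reduces to `V` modulo `m_A`. -/
theorem flat_submodule_iff_automorphism (K A : Type*) [Field K] [CommRing A]
    [Algebra K A] [IsLocalRing A] [IsArtinianRing A]
    (ε : A →ₐ[K] K) (hε : RingHom.ker (ε : A →+* K) = IsLocalRing.maximalIdeal A)
    (W : Type*) [AddCommGroup W] [Module K W] (V : Submodule K W) :
    (∀ N : Submodule A (A ⊗[K] W), Module.Flat A ↥N →
      Submodule.map (red K A ε W) (N.restrictScalars K) = V →
      N.restrictScalars K ⊓ LinearMap.ker (red K A ε W) =
        (IsLocalRing.maximalIdeal A • N).restrictScalars K →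
      ∃ f : (A ⊗[K] W) ≃ₗ[A] (A ⊗[K] W),
        (∀ x, f x - x ∈
          IsLocalRing.maximalIdeal A • (⊤ : Submodule A (A ⊗[K] W))) ∧
        Submodule.map (f : (A ⊗[K] W) →ₗ[A] (A ⊗[K] W)) (V.baseChange A) = N) ∧
    (∀ f : (A ⊗[K] W) ≃ₗ[A] (A ⊗[K] W),
      (∀ x, f x - x ∈
        IsLocalRing.maximalIdeal A • (⊤ : Submodule A (A ⊗[K] W))) →
      Module.Free A
        ↥(Submodule.map (f : (A ⊗[K] W) →ₗ[A] (A ⊗[K] W)) (V.baseChange A)) ∧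
      Submodule.map (red K A ε W)
        ((Submodule.map (f : (A ⊗[K] W) →ₗ[A] (A ⊗[K] W))
          (V.baseChange A)).restrictScalars K) = V) := by
  have hnil : IsNilpotent (IsLocalRing.maximalIdeal A) := by
    rw [← IsLocalRing.jacobson_eq_maximalIdeal ⊥ bot_ne_top]
    exact IsArtinianRing.isNilpotent_jacobson_bot
  have hred1 : ∀ w : W, red K A ε W (1 ⊗ₜ w) = w := fun w => by simp [red_tmul']
  refine ⟨?_, ?_⟩
  · intro N _ hmap hker
    obtain ⟨V', hV'⟩ := Submodule.exists_isCompl V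
    let p : W →ₗ[K] V := V.projectionOnto V' hV'
    let ρ : N.restrictScalars K →ₗ[K] V :=
      (red K A ε W ∘ₗ (N.restrictScalars K).subtype).codRestrict V (fun x => by
        rw [← hmap]; exact ⟨x, x.2, rfl⟩)
    have hρ : Function.Surjective ρ := by
      rintro ⟨v, hv⟩
      obtain ⟨x, hx, rfl⟩ := hmap.symm ▸ hv
      exact ⟨⟨x, hx⟩, rfl⟩
    obtain ⟨s, hs⟩ := ρ.exists_rightInverse_of_surjective (LinearMap.range_eq_top.2 hρ)
    have hs' : ∀ v : V, red K A ε W (s v : A ⊗[K] W) = v := fun v =>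
      congrArg Subtype.val (LinearMap.congr_fun hs v)
    let g : W →ₗ[K] A ⊗[K] W :=
      (N.restrictScalars K).subtype ∘ₗ s ∘ₗ p +
        (TensorProduct.mk K A W 1) ∘ₗ (LinearMap.id - V.subtype ∘ₗ p)
    have hg : ∀ w, red K A ε W (g w) = w := by
      intro w
      simp [g, hs', hred1, TensorProduct.tmul_sub]
    have hgV : ∀ v : V, g v = s v := by
      intro v
      have : p v = v := Submodule.projectionOnto_apply_left hV' v
      simp [g, this]
    let F : A ⊗[K] W →ₗ[A] A ⊗[K] W := LinearMap.liftBaseChange A g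
    have hF : ∀ a w, F (a ⊗ₜ w) = a • g w := fun a w => by simp [F]
    have hsub : ∀ x, F x - x ∈
        IsLocalRing.maximalIdeal A • (⊤ : Submodule A (A ⊗[K] W)) := by
      intro x
      have h0 : red K A ε W (F x) = red K A ε W x := by
        induction x with
        | zero => simp
        | add x y hx hy => simp only [map_add, hx, hy]
        | tmul a w => rw [hF, red_smul', hg, red_tmul']
      have := sub_red_mem K A ε hε W (F x - x)
      rwa [map_sub, h0, sub_self, TensorProduct.tmul_zero, sub_zero] at this
    have hu := bij_of_sub_mem _ hnil F hsub
    refine ⟨LinearEquiv.ofBijective F ((Module.End.isUnit_iff F).1 hu), hsub, ?_⟩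
    have hle : Submodule.map F (V.baseChange A) ≤ N := by
      rw [Submodule.baseChange_eq_span, Submodule.map_span_le]
      rintro _ ⟨v, hv, rfl⟩
      have : F (1 ⊗ₜ v) = s ⟨v, hv⟩ := by rw [hF, one_smul]; exact hgV ⟨v, hv⟩
      change F (1 ⊗ₜ v) ∈ N
      rw [this]
      exact (s ⟨v, hv⟩).2
    refine le_antisymm hle ?_
    refine nilp_nakayama _ hnil _ _ ?_
    intro x hx
    have hv : red K A ε W x ∈ V := by rw [← hmap]; exact ⟨x, hx, rfl⟩
    have h1 : F (1 ⊗ₜ red K A ε W x) = s ⟨_, hv⟩ := by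
      rw [hF, one_smul]; exact hgV ⟨_, hv⟩
    rw [← add_sub_cancel (F (1 ⊗ₜ red K A ε W x)) x]
    refine Submodule.add_mem_sup ⟨_, Submodule.tmul_mem_baseChange_of_mem 1 hv, rfl⟩ ?_
    have : x - F (1 ⊗ₜ red K A ε W x) ∈
        N.restrictScalars K ⊓ LinearMap.ker (red K A ε W) := by
      refine ⟨?_, ?_⟩
      · rw [h1]; exact N.sub_mem hx (s ⟨_, hv⟩).2
      · change red K A ε W _ = 0
        rw [h1, map_sub, hs', sub_self]
    rw [hker] at this
    exact this
  · intro f hf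
    have hfr : ∀ x, red K A ε W (f x) = red K A ε W x := fun x => by
      rw [← sub_eq_zero, ← map_sub]; exact red_mem_zero K A ε hε W _ (hf x)
    refine ⟨?_, ?_⟩
    · have e1 := f.submoduleMap (V.baseChange A)
      have hinj : Function.Injective (V.subtype.baseChange A) :=
        Module.Flat.lTensor_preserves_injective_linearMap (M := A) V.subtype V.subtype_injective
      have e2 := LinearEquiv.ofInjective _ hinj
      have : Module.Free A (V.baseChange A) := by
        exact Module.Free.of_equiv e2
      exact Module.Free.of_equiv e1
    · apply le_antisymm
      · rintro _ ⟨_, ⟨x, hx, rfl⟩, rfl⟩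
        change red K A ε W (f x) ∈ V
        rw [hfr]
        rw [SetLike.mem_coe, Submodule.baseChange_eq_span] at hx
        induction hx using Submodule.span_induction with
        | mem x h =>
          obtain ⟨v, hv, rfl⟩ := h
          change red K A ε W (1 ⊗ₜ v) ∈ V
          rwa [hred1]
        | zero => simp
        | add x y _ _ h1 h2 => rw [map_add]; exact V.add_mem h1 h2
        | smul a x _ h => rw [red_smul']; exact V.smul_mem _ h
      · intro v hv
        refine ⟨f (1 ⊗ₜ v), ⟨_, Submodule.tmul_mem_baseChange_of_mem 1 hv, rfl⟩, ?_⟩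
        rw [hfr, hred1]
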